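/- arXiv:2104.14947 — 3 statements merged into one kernel-verified Lean document; each statement's English description precedes it below -/
import Mathlib

section
/- Let k \ge 2 be an integer. The number of simultaneous-conjugacy classes of transitive triples (\sigma_1, \sigma_2, \sigma_3) in S_{2k} with \sigma_1 \circ \sigma_2 = \sigma_3 such that \sigma_1 has cycle type (2k-1, 1), i.e. one (2k-1)-cycle and one fixed point, \sigma_2 has cycle type (4, 2, \ldots, 2) consisting of one 4-cycle and k-2 transpositions, and \sigma_3 has cycle type (2, \ldots, 2, 1, 1) consisting of k-1 transpositions and two fixed points, equals k-1. -/
/-- The cycle type of a permutation of `Fin d` *including fixed points as parts equal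
to 1*: the partition of `d` formed by the lengths of all cycles of `σ`. -/
def fullCycleType {d : ℕ} (σ : Equiv.Perm (Fin d)) : Multiset ℕ :=
  σ.cycleType + Multiset.replicate (d - σ.cycleType.sum) 1

/-- The subgroup generated by `σ₁` and `σ₂` acts transitively on the `d` letters. -/
def IsTransitivePair {d : ℕ} (σ₁ σ₂ : Equiv.Perm (Fin d)) : Prop :=
  ∀ x y : Fin d, ∃ τ ∈ Subgroup.closure ({σ₁, σ₂} : Set (Equiv.Perm (Fin d))), τ x = y

/-- Transitive triples `(σ₁, σ₂, σ₃)` in `S_d` with `σ₁ ∘ σ₂ = σ₃` and prescribed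
cycle types `t₁, t₂, t₃` (fixed points included as parts equal to 1). -/
def HurwitzTriples (d : ℕ) (t₁ t₂ t₃ : Multiset ℕ) :
    Set (Equiv.Perm (Fin d) × Equiv.Perm (Fin d) × Equiv.Perm (Fin d)) :=
  {p | p.1 * p.2.1 = p.2.2 ∧ fullCycleType p.1 = t₁ ∧ fullCycleType p.2.1 = t₂ ∧
    fullCycleType p.2.2 = t₃ ∧ IsTransitivePair p.1 p.2.1}

/-- Simultaneous conjugation of triples: `(σ₁,σ₂,σ₃) ∼ (τσ₁τ⁻¹, τσ₂τ⁻¹, τσ₃τ⁻¹)`. -/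
def SimConj {d : ℕ} (S : Set (Equiv.Perm (Fin d) × Equiv.Perm (Fin d) × Equiv.Perm (Fin d)))
    (p q : S) : Prop :=
  ∃ τ : Equiv.Perm (Fin d),
    q.1.1 = τ * p.1.1 * τ⁻¹ ∧ q.1.2.1 = τ * p.1.2.1 * τ⁻¹ ∧ q.1.2.2 = τ * p.1.2.2 * τ⁻¹

namespace Hurwitz

open Equiv Equiv.Perm

theorem cycleType_eq_filter {d : ℕ} (σ : Perm (Fin d)) :
    σ.cycleType = (fullCycleType σ).filter (2 ≤ ·) := by
  have h₁ : σ.cycleType.filter (2 ≤ ·) = σ.cycleType :=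
    Multiset.filter_eq_self.2 fun _ h => two_le_of_mem_cycleType h
  have h₂ : (Multiset.replicate (d - σ.cycleType.sum) 1).filter (2 ≤ ·) = 0 :=
    Multiset.filter_eq_nil.2 fun a h => by rw [Multiset.eq_of_mem_replicate h]; norm_num
  rw [fullCycleType, Multiset.filter_add, h₁, h₂, add_zero]

section CycleType

variable {α : Type*} [Fintype α] [DecidableEq α]

theorem pow_eq_one_of_forall_dvd {σ : Perm α} {n : ℕ} (h : ∀ m ∈ σ.cycleType, m ∣ n) :
    σ ^ n = 1 := by
  rw [← orderOf_dvd_iff_pow_eq_one, ← lcm_cycleType]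
  exact Multiset.lcm_dvd.2 h

theorem cycleType_eq_replicate_two {σ : Perm α} (h : ∀ x, σ (σ x) = x) {j : ℕ}
    (hj : σ.support.card = 2 * j) : σ.cycleType = Multiset.replicate j 2 := by
  have h2 : σ ^ 2 = 1 := by
    ext x
    simp [pow_two, h]
  have := Fact.mk Nat.prime_two
  have h3 := cycleType_of_pow_prime_eq_one h2
  have h4 := sum_cycleType σ
  rw [h3] at h4
  simp only [Multiset.sum_replicate, smul_eq_mul] at h4
  rw [h3, show σ.cycleType.card = j by omega]

theorem card_support_cycleOf_eq_four {σ : Perm α} {j : ℕ}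
    (h : σ.cycleType = 4 ::ₘ Multiset.replicate j 2) {x : α} (hx : σ (σ x) ≠ x) :
    (σ.cycleOf x).support.card = 4 := by
  have hx' : σ x ≠ x := fun h' => hx (by rw [h', h'])
  have hm : (σ.cycleOf x).support.card ∈ σ.cycleType := by
    rw [cycleType_def]
    exact Multiset.mem_map_of_mem _
      (cycleOf_mem_cycleFactorsFinset_iff.2 (mem_support.2 hx'))
  rw [h, Multiset.mem_cons] at hm
  refine hm.resolve_right fun h2 => hx ?_
  have h3 := (isCycle_cycleOf σ hx').orderOf
  rw [Multiset.eq_of_mem_replicate h2] at h3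
  have h4 := cycleOf_pow_apply_self σ x 2
  rw [← h3, pow_orderOf_eq_one, h3, pow_two] at h4
  exact h4.symm

theorem exists_pow_eq_of_cycleType {σ : Perm α} {j : ℕ}
    (h : σ.cycleType = 4 ::ₘ Multiset.replicate j 2) {x y : α} (hx : σ (σ x) ≠ x)
    (hy : σ (σ y) ≠ y) : ∃ i < 4, (σ ^ i) x = y := by
  have hx' : σ x ≠ x := fun h' => hx (by rw [h', h'])
  have hy' : σ y ≠ y := fun h' => hy (by rw [h', h'])
  have hc : σ.cycleType.count 4 = 1 := by
    rw [h, Multiset.count_cons_self, Multiset.count_replicate]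
    simp
  rw [cycleType_def, Multiset.count_map, Multiset.card_eq_one] at hc
  obtain ⟨c, hc⟩ := hc
  have key : ∀ z, σ (σ z) ≠ z → σ.cycleOf z = c := by
    intro z hz
    have hz' : σ z ≠ z := fun h' => hz (by rw [h', h'])
    rw [← Multiset.mem_singleton, ← hc, Multiset.mem_filter]
    exact ⟨cycleOf_mem_cycleFactorsFinset_iff.2 (mem_support.2 hz'),
      (card_support_cycleOf_eq_four h hz).symm⟩
  have hs : σ.SameCycle x y :=
    (sameCycle_iff_cycleOf_eq_of_mem_support (mem_support.2 hx') (mem_support.2 hy')).2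
      ((key x hx).trans (key y hy).symm)
  obtain ⟨i, hi, e⟩ := hs.exists_pow_eq_of_mem_support (mem_support.2 hx')
  exact ⟨i, by rwa [card_support_cycleOf_eq_four h hx] at hi, e⟩

theorem cycleType_eq_four_cons {σ : Perm α} {a b c e : α} (hab : σ a = b) (hbc : σ b = c)
    (hce : σ c = e) (hea : σ e = a) (hac : a ≠ c)
    (h : ∀ x, x ≠ a → x ≠ b → x ≠ c → x ≠ e → σ (σ x) = x) (hf : ∀ x, σ x ≠ x) {j : ℕ}
    (hj : Fintype.card α = 2 * j + 4) : σ.cycleType = 4 ::ₘ Multiset.replicate j 2 := by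
  set g := σ.cycleOf a with hg
  have hgc : g.IsCycle := isCycle_cycleOf σ (hf a)
  have hgm : g ∈ σ.cycleFactorsFinset :=
    cycleOf_mem_cycleFactorsFinset_iff.2 (mem_support.2 (hf a))
  have hgpow : ∀ n, (g ^ n) a = (σ ^ n) a := cycleOf_pow_apply_self σ a
  have ho : orderOf g = 4 := by
    have := Fact.mk Nat.prime_two
    refine orderOf_eq_prime_pow (p := 2) (n := 1) ?_ ?_
    · intro h1
      have h2 := hgpow 2
      simp only [pow_one] at h1
      rw [h1, pow_two] at h2
      simp [hab, hbc] at h2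
      exact hac h2
    · refine hgc.pow_eq_one_iff.2 ⟨a, ?_, ?_⟩
      · rw [hg, cycleOf_apply_self]
        exact hf a
      · rw [hgpow]
        simp [pow_succ, hab, hbc, hce, hea]
  have hcard : g.support.card = 4 := by rw [← hgc.orderOf, ho]
  have hd : (σ * g⁻¹).Disjoint g := disjoint_mul_inv_of_mem_cycleFactorsFinset hgm
  have hσ : σ = (σ * g⁻¹) * g := by simp
  have hct : σ.cycleType = (σ * g⁻¹).cycleType + {4} := by
    conv_lhs => rw [hσ]
    rw [hd.cycleType_mul, hgc.cycleType, hcard]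
  set ρ := σ * g⁻¹ with hρ
  have hρ2 : ∀ x, ρ (ρ x) = x := by
    intro x
    rcases hd x with hx | hx
    · rw [hx, hx]
    · have hgx : g (ρ x) = ρ x := by
        rw [← mul_apply, ← hd.commute.eq, mul_apply, hx]
      have hx1 : σ x = ρ x := by
        conv_lhs => rw [hσ]
        rw [mul_apply, hx]
      have hx2 : σ (ρ x) = ρ (ρ x) := by
        conv_lhs => rw [hσ]
        rw [mul_apply, hgx]
      rw [← hx2, ← hx1]
      have hsame : ∀ n : ℕ, x ≠ (σ ^ n) a := by
        rintro n rfl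
        rw [hg, cycleOf_apply_apply_pow_self, pow_succ', mul_apply] at hx
        exact hf _ hx
      refine h x (hsame 0) ?_ ?_ ?_
      · simpa [hab] using hsame 1
      · simpa [pow_succ, hab, hbc] using hsame 2
      · simpa [pow_succ, hab, hbc, hce] using hsame 3
  have hsum := sum_cycleType σ
  have hsupp : σ.support = Finset.univ := by
    ext x
    simp [hf x]
  rw [hct, hsupp, Multiset.sum_add, Finset.card_univ, hj, sum_cycleType,
    Multiset.sum_singleton] at hsum
  rw [hct, cycleType_eq_replicate_two hρ2 (j := j) (by omega), add_comm]
  rfl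

end CycleType

/-- The `(2k-1)`-cycle `0 → 1 → ⋯ → 2k-2 → 0` on `2k` letters, fixing the last letter. -/
def rot {k : ℕ} (hk : 2 ≤ k) : Perm (Fin (2 * k)) :=
  Fin.cycleRange ⟨2 * k - 2, by omega⟩

theorem rot_val {k : ℕ} (hk : 2 ≤ k) (x : Fin (2 * k)) :
    (rot hk x : ℕ) = if (x : ℕ) < 2 * k - 2 then (x : ℕ) + 1
      else if (x : ℕ) = 2 * k - 2 then 0 else x := by
  have : NeZero (2 * k) := ⟨by omega⟩
  rw [rot]
  split_ifs with h₁ h₂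
  · exact Fin.coe_cycleRange_of_lt (Fin.lt_def.2 h₁)
  · rw [Fin.cycleRange_of_eq (Fin.ext h₂)]
    rfl
  · rw [Fin.cycleRange_of_gt (Fin.lt_def.2 (by simp only; omega))]

theorem cycleType_rot {k : ℕ} (hk : 2 ≤ k) : (rot hk).cycleType = {2 * k - 1} := by
  have : NeZero (2 * k) := ⟨by omega⟩
  rw [rot, Fin.cycleType_cycleRange]
  · congr 1
    simp only
    omega
  · intro h
    have := congrArg Fin.val h
    simp at this
    omega

theorem fullCycleType_rot {k : ℕ} (hk : 2 ≤ k) : fullCycleType (rot hk) = {2 * k - 1, 1} := by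
  rw [fullCycleType, cycleType_rot, Multiset.sum_singleton,
    show 2 * k - (2 * k - 1) = 1 by omega]
  rfl

theorem rot_pow_zero {k : ℕ} (hk : 2 ≤ k) (i : ℕ) (hi : i < 2 * k - 1) :
    (rot hk ^ i) ⟨0, by omega⟩ = ⟨i, by omega⟩ := by
  induction i with
  | zero => rfl
  | succ i ih =>
    rw [pow_succ', mul_apply, ih (by omega)]
    ext
    rw [rot_val, if_pos (by simp only; omega)]

theorem rot_pow_last {k : ℕ} (hk : 2 ≤ k) (i : ℕ) :
    (rot hk ^ i) ⟨2 * k - 1, by omega⟩ = ⟨2 * k - 1, by omega⟩ := by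
  induction i with
  | zero => rfl
  | succ i ih =>
    rw [pow_succ', mul_apply, ih]
    ext
    rw [rot_val, if_neg (by simp only; omega), if_neg (by simp only; omega)]

/-- The involution swapping `0` with `2k-1` and reversing each of the intervals `[1, 2b+1]` and
`[2b+2, 2k-2]`. -/
def flip {k : ℕ} (b : Fin (k - 1)) : Perm (Fin (2 * k)) :=
  Function.Involutive.toPerm
    (fun x => ⟨if (x : ℕ) = 0 then 2 * k - 1 else if (x : ℕ) ≤ 2 * b + 1 then 2 * b + 2 - x
      else if (x : ℕ) < 2 * k - 1 then 2 * b + 2 * k - x else 0, by split_ifs <;> omega⟩)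
    (fun x => by
      ext
      simp only
      split_ifs <;> omega)

theorem flip_val {k : ℕ} (b : Fin (k - 1)) (x : Fin (2 * k)) :
    (flip b x : ℕ) = if (x : ℕ) = 0 then 2 * k - 1
      else if (x : ℕ) ≤ 2 * b + 1 then 2 * b + 2 - x
      else if (x : ℕ) < 2 * k - 1 then 2 * b + 2 * k - x else 0 := rfl

theorem flip_flip {k : ℕ} (b : Fin (k - 1)) (x : Fin (2 * k)) : flip b (flip b x) = x := by
  ext
  simp only [flip_val]
  split_ifs <;> omega

theorem flip_injective {k : ℕ} : Function.Injective (flip : Fin (k - 1) → Perm (Fin (2 * k))) := by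
  intro b c h
  have hb := b.2
  have h₁ := congrArg Fin.val (Equiv.congr_fun h (⟨1, by omega⟩ : Fin (2 * k)))
  simp only [flip_val] at h₁
  ext
  split_ifs at h₁ <;> first | omega | contradiction

theorem fullCycleType_flip {k : ℕ} (b : Fin (k - 1)) :
    fullCycleType (flip b) = Multiset.replicate (k - 1) 2 + Multiset.replicate 2 1 := by
  have hs : (flip b).support = Finset.univ \ {⟨b + 1, by omega⟩, ⟨b + k, by omega⟩} := by
    ext x
    simp only [mem_support, ne_eq, Fin.ext_iff, flip_val, Finset.mem_sdiff, Finset.mem_univ,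
      true_and, Finset.mem_insert, Finset.mem_singleton]
    split_ifs <;> omega
  have hne : (⟨b + 1, by omega⟩ : Fin (2 * k)) ≠ ⟨b + k, by omega⟩ := by
    simp only [ne_eq, Fin.mk.injEq]
    omega
  have hc : (flip b).support.card = 2 * (k - 1) := by
    rw [hs, Finset.card_sdiff_of_subset (Finset.subset_univ _), Finset.card_univ, Fintype.card_fin,
      Finset.card_pair hne]
    omega
  rw [fullCycleType, sum_cycleType, hc, cycleType_eq_replicate_two (flip_flip b) hc,
    show 2 * k - 2 * (k - 1) = 2 by omega]

/-- The second permutation of the triple with `σ₁ = rot hk` and `σ₃ = flip b`. -/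
def quad {k : ℕ} (hk : 2 ≤ k) (b : Fin (k - 1)) : Perm (Fin (2 * k)) :=
  (rot hk)⁻¹ * flip b

theorem quad_val {k : ℕ} (hk : 2 ≤ k) (b : Fin (k - 1)) (x : Fin (2 * k)) :
    (quad hk b x : ℕ) = if (x : ℕ) = 0 then 2 * k - 1
      else if (x : ℕ) ≤ 2 * b + 1 then 2 * b + 1 - x
      else if (x : ℕ) < 2 * k - 1 then 2 * b + 2 * k - 1 - x else 2 * k - 2 := by
  have h : rot hk (quad hk b x) = flip b x := by simp [quad]
  have h' := congrArg Fin.val h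
  rw [rot_val, flip_val] at h'
  split_ifs at h' ⊢ <;> omega

theorem fullCycleType_quad {k : ℕ} (hk : 2 ≤ k) (b : Fin (k - 1)) :
    fullCycleType (quad hk b) = 4 ::ₘ Multiset.replicate (k - 2) 2 := by
  have h : (quad hk b).cycleType = 4 ::ₘ Multiset.replicate (k - 2) 2 := by
    refine cycleType_eq_four_cons (a := ⟨0, by omega⟩) (b := ⟨2 * k - 1, by omega⟩)
      (c := ⟨2 * k - 2, by omega⟩) (e := ⟨2 * b + 1, by omega⟩) ?_ ?_ ?_ ?_ ?_ ?_ ?_ ?_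
    · ext
      simp only [quad_val]
      split_ifs <;> omega
    · ext
      simp only [quad_val]
      split_ifs <;> omega
    · ext
      simp only [quad_val]
      split_ifs <;> omega
    · ext
      simp only [quad_val]
      split_ifs <;> first | omega | simp_all
    · simp only [ne_eq, Fin.mk.injEq]
      omega
    · intro x
      simp only [ne_eq, Fin.ext_iff, quad_val]
      intros
      split_ifs <;> omega
    · intro x
      simp only [ne_eq, Fin.ext_iff, quad_val]
      split_ifs <;> omega
    · rw [Fintype.card_fin]
      omega
  rw [fullCycleType, h, Multiset.sum_cons, Multiset.sum_replicate, smul_eq_mul,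
    show 2 * k - (4 + (k - 2) * 2) = 0 by omega]
  simp

theorem isTransitivePair_of_forall {d : ℕ} {σ₁ σ₂ : Perm (Fin d)} (a : Fin d)
    (h : ∀ x, ∃ τ ∈ Subgroup.closure ({σ₁, σ₂} : Set (Perm (Fin d))), τ a = x) :
    IsTransitivePair σ₁ σ₂ := by
  intro x y
  obtain ⟨τ, hτ, rfl⟩ := h x
  obtain ⟨τ', hτ', rfl⟩ := h y
  exact ⟨τ' * τ⁻¹, mul_mem hτ' (inv_mem hτ), by simp⟩

/-- The triples `(rot hk, quad hk b, flip b)`, which represent all the classes. -/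
def triple {k : ℕ} (hk : 2 ≤ k) (b : Fin (k - 1)) :
    HurwitzTriples (2 * k) {2 * k - 1, 1} (4 ::ₘ Multiset.replicate (k - 2) 2)
      (Multiset.replicate (k - 1) 2 + Multiset.replicate 2 1) :=
  ⟨(rot hk, quad hk b, flip b), by simp [quad], fullCycleType_rot hk, fullCycleType_quad hk b,
    fullCycleType_flip b, by
      refine isTransitivePair_of_forall ⟨0, by omega⟩ fun x => ?_
      by_cases hx : (x : ℕ) < 2 * k - 1
      · exact ⟨rot hk ^ (x : ℕ), pow_mem (Subgroup.subset_closure (by simp)) _,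
          rot_pow_zero hk x hx⟩
      · refine ⟨quad hk b, Subgroup.subset_closure (by simp), ?_⟩
        ext
        rw [quad_val, if_pos rfl]
        omega⟩

theorem eq_flip_of_normalized {k : ℕ} (hk : 2 ≤ k) {σ₂ σ₃ : Perm (Fin (2 * k))}
    (h : rot hk * σ₂ = σ₃) (h₂ : σ₂.cycleType = 4 ::ₘ Multiset.replicate (k - 2) 2)
    (h₃ : σ₃.cycleType = Multiset.replicate (k - 1) 2)
    (h₀ : σ₃ ⟨2 * k - 1, by omega⟩ = ⟨0, by omega⟩) : ∃ b, flip b = σ₃ := by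
  have inv₃ : ∀ x, σ₃ (σ₃ x) = x := by
    have h1 : σ₃ ^ 2 = 1 := pow_eq_one_of_forall_dvd fun m hm => by
      rw [h₃] at hm
      rw [Multiset.eq_of_mem_replicate hm]
    intro x
    rw [← mul_apply, ← pow_two, h1, one_apply]
  have pow₂ : σ₂ ^ 4 = 1 := pow_eq_one_of_forall_dvd fun m hm => by
    rw [h₂, Multiset.mem_cons] at hm
    rcases hm with rfl | hm
    · rfl
    · rw [Multiset.eq_of_mem_replicate hm]
      norm_num
  have hrot : ∀ x, rot hk (σ₂ x) = σ₃ x := fun x => by rw [← mul_apply, h]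
  have h₀' : σ₃ ⟨0, by omega⟩ = ⟨2 * k - 1, by omega⟩ := by rw [← h₀, inv₃]
  have e₁ : σ₂ ⟨0, by omega⟩ = ⟨2 * k - 1, by omega⟩ := by
    apply (rot hk).injective
    rw [hrot, h₀']
    ext
    simp only [rot_val]
    split_ifs <;> omega
  have e₂ : σ₂ ⟨2 * k - 1, by omega⟩ = ⟨2 * k - 2, by omega⟩ := by
    apply (rot hk).injective
    rw [hrot, h₀]
    ext
    simp only [rot_val]
    split_ifs <;> omega
  obtain ⟨m, e₃⟩ : ∃ m, σ₂ ⟨2 * k - 2, by omega⟩ = m := ⟨_, rfl⟩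
  have e₄ : σ₂ m = ⟨0, by omega⟩ := by
    have := Equiv.congr_fun pow₂ ⟨0, by omega⟩
    simpa [pow_succ, e₁, e₂, e₃] using this
  have hm₀ : (m : ℕ) ≠ 0 := by
    intro hm
    rw [show m = ⟨0, by omega⟩ from Fin.ext hm, e₁, Fin.mk.injEq] at e₄
    omega
  have hm₁ : (m : ℕ) ≠ 2 * k - 1 := by
    intro hm
    rw [show m = ⟨2 * k - 1, by omega⟩ from Fin.ext hm, e₂, Fin.mk.injEq] at e₄
    omega
  have hm₂ : (m : ℕ) ≠ 2 * k - 2 := by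
    intro hm
    rw [show m = ⟨2 * k - 2, by omega⟩ from Fin.ext hm] at e₃
    have := σ₂.injective (e₃.trans e₂.symm)
    rw [Fin.mk.injEq] at this
    omega
  have hm : (m : ℕ) < 2 * k - 2 := by omega
  have step : ∀ (j : ℕ) (hj : j < 2 * k - 2), j ≠ 0 → j ≠ m →
      (rot hk (σ₃ ⟨j + 1, by omega⟩) : ℕ) = σ₃ ⟨j, by omega⟩ := by
    intro j hj hj₀ hjm
    have hx : σ₂ (σ₂ ⟨j, by omega⟩) = ⟨j, by omega⟩ := by
      by_contra hne
      have h0 : σ₂ (σ₂ ⟨0, by omega⟩) ≠ ⟨0, by omega⟩ := by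
        rw [e₁, e₂, ne_eq, Fin.mk.injEq]
        omega
      obtain ⟨i, hi, hij⟩ := exists_pow_eq_of_cycleType h₂ h0 hne
      have hij' := congrArg Fin.val hij
      interval_cases i <;> simp [pow_succ, e₁, e₂, e₃] at hij' <;> omega
    have hr : rot hk ⟨j, by omega⟩ = ⟨j + 1, by omega⟩ := by
      ext
      rw [rot_val, if_pos hj]
    rw [← hr, ← hrot ⟨j, by omega⟩]
    congr 2
    rw [← inv₃ (σ₂ ⟨j, _⟩), ← hrot (σ₂ ⟨j, _⟩), hx]
  have f₁ : σ₃ ⟨1, by omega⟩ = m := by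
    rw [← inv₃ m, ← hrot m, e₄]
    congr 1
    ext
    rw [rot_val, if_pos (by simp only; omega)]
  have f₂ : σ₃ ⟨m + 1, by omega⟩ = ⟨2 * k - 2, by omega⟩ := by
    rw [← inv₃ ⟨2 * k - 2, _⟩, ← hrot ⟨2 * k - 2, _⟩, e₃]
    congr 1
    ext
    rw [rot_val, if_pos hm]
  have g₁ : ∀ j : ℕ, 1 ≤ j → ∀ hj : j ≤ (m : ℕ), (σ₃ ⟨j, by omega⟩ : ℕ) = (m : ℕ) + 1 - j := by
    intro j hj1
    induction j, hj1 using Nat.le_induction with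
    | base =>
      intro _
      rw [f₁]
      omega
    | succ j hj1 ih =>
      intro hj
      have := step j (by omega) (by omega) (by omega)
      rw [ih (by omega), rot_val] at this
      split_ifs at this <;> omega
  have g₂ : ∀ j : ℕ, (m : ℕ) + 1 ≤ j → ∀ hj : j ≤ 2 * k - 2,
      (σ₃ ⟨j, by omega⟩ : ℕ) = 2 * k - 1 + m - j := by
    intro j hj1
    induction j, hj1 using Nat.le_induction with
    | base =>
      intro _
      rw [f₂]
      simp only
      omega
    | succ j hj1 ih =>
      intro hj
      have := step j (by omega) (by omega) (by omega)
      rw [ih (by omega), rot_val] at this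
      split_ifs at this <;> omega
  have hodd : (m : ℕ) % 2 = 1 := by
    have hfix : ∃ x, σ₃ x = x := by
      by_contra! hne
      have hsum := sum_cycleType σ₃
      rw [show σ₃.support = Finset.univ by ext x; simp [hne x], h₃, Multiset.sum_replicate,
        Finset.card_univ, Fintype.card_fin, smul_eq_mul] at hsum
      omega
    obtain ⟨x, hx⟩ := hfix
    have hx' := congrArg Fin.val hx
    rcases Nat.lt_or_ge m x with h1 | h1
    · rcases Nat.lt_or_ge (2 * k - 2) x with h4 | h4
      · rw [show x = ⟨2 * k - 1, by omega⟩ from Fin.ext (by simp only; omega), h₀,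
          Fin.mk.injEq] at hx
        omega
      · have := g₂ x h1 h4
        simp only [Fin.eta] at this
        omega
    · rcases Nat.eq_zero_or_pos x with h4 | h4
      · rw [show x = ⟨0, by omega⟩ from Fin.ext h4, h₀', Fin.mk.injEq] at hx
        omega
      · have := g₁ x h4 h1
        simp only [Fin.eta] at this
        omega
  refine ⟨⟨(m : ℕ) / 2, by omega⟩, ?_⟩
  ext x
  simp only [flip_val]
  split_ifs with c₁ c₂ c₃
  · rw [show x = ⟨0, by omega⟩ from Fin.ext c₁, h₀']
  · have := g₁ x (by omega) (by omega)
    simp only [Fin.eta] at this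
    omega
  · have := g₂ x (by omega) (by omega)
    simp only [Fin.eta] at this
    omega
  · rw [show x = ⟨2 * k - 1, by omega⟩ from Fin.ext (by simp only; omega), h₀]

theorem simConj_equivalence {d : ℕ}
    (S : Set (Perm (Fin d) × Perm (Fin d) × Perm (Fin d))) : Equivalence (SimConj S) where
  refl p := ⟨1, by simp⟩
  symm := by
    rintro p q ⟨τ, h₁, h₂, h₃⟩
    refine ⟨τ⁻¹, ?_, ?_, ?_⟩ <;> simp only [h₁, h₂, h₃] <;> group
  trans := by
    rintro p q r ⟨τ, h₁, h₂, h₃⟩ ⟨τ', h₁', h₂', h₃'⟩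
    refine ⟨τ' * τ, ?_, ?_, ?_⟩ <;> simp only [h₁, h₂, h₃, h₁', h₂', h₃'] <;> group

theorem eq_of_simConj_triple {k : ℕ} (hk : 2 ≤ k) {b c : Fin (k - 1)}
    (h : SimConj _ (triple hk b) (triple hk c)) : b = c := by
  obtain ⟨τ, h₁, -, h₃⟩ := h
  simp only [triple] at h₁ h₃
  have hc : Commute τ (rot hk) := by
    rw [eq_mul_inv_iff_mul_eq] at h₁
    exact h₁.symm
  have hlast : τ ⟨2 * k - 1, by omega⟩ = ⟨2 * k - 1, by omega⟩ := by
    have hfix : rot hk (τ ⟨2 * k - 1, by omega⟩) = τ ⟨2 * k - 1, by omega⟩ := by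
      rw [← mul_apply, ← hc.eq, mul_apply]
      congr 1
      exact (by simpa using rot_pow_last hk 1)
    have := congrArg Fin.val hfix
    rw [rot_val] at this
    ext
    split_ifs at this <;> simp only <;> omega
  have hz : ∀ c : Fin (k - 1), flip c ⟨2 * k - 1, by omega⟩ = ⟨0, by omega⟩ := by
    intro c
    ext
    simp only [flip_val]
    split_ifs <;> omega
  have h0 : τ ⟨0, by omega⟩ = ⟨0, by omega⟩ := by
    rw [eq_mul_inv_iff_mul_eq] at h₃
    rw [← hz b, ← mul_apply, ← h₃, mul_apply, hlast, hz c, hz b]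
  have hτ : τ = 1 := by
    ext x
    by_cases hx : (x : ℕ) < 2 * k - 1
    · have e := rot_pow_zero hk x hx
      simp only [Fin.eta] at e
      rw [← e, ← mul_apply, (hc.pow_right _).eq, mul_apply, h0, one_apply]
    · rw [show x = ⟨2 * k - 1, by omega⟩ from Fin.ext (by simp only; omega), hlast, one_apply]
  refine flip_injective ?_
  rw [h₃, hτ]
  simp

theorem exists_simConj_triple {k : ℕ} (hk : 2 ≤ k)
    (p : HurwitzTriples (2 * k) {2 * k - 1, 1} (4 ::ₘ Multiset.replicate (k - 2) 2)
      (Multiset.replicate (k - 1) 2 + Multiset.replicate 2 1)) :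
    ∃ b, SimConj _ p (triple hk b) := by
  obtain ⟨⟨σ₁, σ₂, σ₃⟩, hp⟩ := p
  obtain ⟨h, t₁, t₂, t₃, -⟩ := id hp
  simp only at h t₁ t₂ t₃
  have c₁ : σ₁.cycleType = {2 * k - 1} := by
    rw [cycleType_eq_filter, t₁, Multiset.insert_eq_cons,
      Multiset.filter_cons_of_pos _ (by omega), Multiset.filter_singleton, if_neg (by norm_num)]
    rfl
  have c₂ : σ₂.cycleType = 4 ::ₘ Multiset.replicate (k - 2) 2 := by
    rw [cycleType_eq_filter, t₂]
    refine Multiset.filter_eq_self.2 fun a ha => ?_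
    rw [Multiset.mem_cons] at ha
    rcases ha with rfl | ha
    · norm_num
    · rw [Multiset.eq_of_mem_replicate ha]
  have c₃ : σ₃.cycleType = Multiset.replicate (k - 1) 2 := by
    rw [cycleType_eq_filter, t₃, Multiset.filter_add,
      Multiset.filter_eq_self.2 fun a ha => by rw [Multiset.eq_of_mem_replicate ha],
      Multiset.filter_eq_nil.2 fun a ha => by rw [Multiset.eq_of_mem_replicate ha]; norm_num,
      add_zero]
  have hf : ∀ x, σ₂ x ≠ x := by
    have hs : σ₂.support = Finset.univ := by
      rw [← Finset.card_eq_iff_eq_univ, ← sum_cycleType, c₂, Multiset.sum_cons,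
        Multiset.sum_replicate, smul_eq_mul, Fintype.card_fin]
      omega
    intro x
    rw [← mem_support, hs]
    exact Finset.mem_univ x
  obtain ⟨τ, hτ⟩ := isConj_iff.1 (isConj_iff_cycleType_eq.2 (c₁.trans (cycleType_rot hk).symm))
  obtain ⟨q, hq⟩ : ∃ q, (τ * σ₃ * τ⁻¹) ⟨2 * k - 1, by omega⟩ = q := ⟨_, rfl⟩
  have hrot : rot hk * (τ * σ₂ * τ⁻¹) = τ * σ₃ * τ⁻¹ := by
    rw [← hτ, ← h]
    group
  have hql : (q : ℕ) < 2 * k - 1 := by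
    by_contra hlt
    rw [show q = ⟨2 * k - 1, by omega⟩ from Fin.ext (by simp only; omega), ← hrot,
      mul_apply] at hq
    have h1 := (rot hk).injective (hq.trans (by simpa using (rot_pow_last hk 1).symm))
    rw [mul_apply, mul_apply, ← eq_inv_iff_eq] at h1
    exact hf _ h1
  set ν := (rot hk ^ (q : ℕ))⁻¹ * τ with hν
  have hν₁ : ν * σ₁ * ν⁻¹ = rot hk := by
    rw [hν, mul_inv_rev, inv_inv, ← mul_assoc, mul_assoc _ τ, mul_assoc _ (τ * σ₁), hτ, mul_assoc,
      ← pow_succ', pow_succ, inv_mul_cancel_left]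
  have hν₃ : (ν * σ₃ * ν⁻¹) ⟨2 * k - 1, by omega⟩ = ⟨0, by omega⟩ := by
    have : ν * σ₃ * ν⁻¹ = (rot hk ^ (q : ℕ))⁻¹ * (τ * σ₃ * τ⁻¹) * rot hk ^ (q : ℕ) := by
      rw [hν]
      group
    rw [this, mul_apply, mul_apply, rot_pow_last, hq, inv_eq_iff_eq, rot_pow_zero hk q hql]
  have hmul : rot hk * (ν * σ₂ * ν⁻¹) = ν * σ₃ * ν⁻¹ := by
    rw [← hν₁, ← h]
    group
  obtain ⟨b, hb⟩ := eq_flip_of_normalized hk hmul (by rw [cycleType_conj, c₂])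
    (by rw [cycleType_conj, c₃]) hν₃
  refine ⟨b, ν, hν₁.symm, ?_, hb⟩
  simp only [triple, quad]
  rw [hb, ← hmul, inv_mul_cancel_left]

end Hurwitz

/-- Proposition 2.3, row 5: for `k ≥ 2`, the number of simultaneous-conjugacy classes
of transitive triples `(σ₁, σ₂, σ₃)` in `S_{2k}` with `σ₁σ₂ = σ₃`, `σ₁` of cycle type
`(2k-1, 1)`, `σ₂` of cycle type `(4, 2, …, 2)` and `σ₃` of cycle type `(2, …, 2, 1, 1)`
equals `k - 1`. -/
theorem hurwitz_count_row5 (k : ℕ) (hk : 2 ≤ k) :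
    Nat.card (Quot (SimConj
      (HurwitzTriples (2 * k) {2 * k - 1, 1} (4 ::ₘ Multiset.replicate (k - 2) 2)
        (Multiset.replicate (k - 1) 2 + Multiset.replicate 2 1)))) = k - 1 := by
  have hbij : Function.Bijective fun b : Fin (k - 1) =>
      Quot.mk (SimConj _) (Hurwitz.triple hk b) := by
    refine ⟨fun b c h => ?_, fun x => ?_⟩
    · exact Hurwitz.eq_of_simConj_triple hk
        ((Hurwitz.simConj_equivalence _).quot_mk_eq_iff _ _ |>.1 h)
    · induction x using Quot.ind with
      | mk p =>
        obtain ⟨b, hb⟩ := Hurwitz.exists_simConj_triple hk p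
        exact ⟨b, (Quot.sound hb).symm⟩
  rw [← Nat.card_eq_of_bijective _ hbij, Nat.card_fin]
end

section
/- Let k \ge 2 be an integer. The number of simultaneous-conjugacy classes of transitive triples (\sigma_1, \sigma_2, \sigma_3) in S_{2k} with \sigma_1 \circ \sigma_2 = \sigma_3 such that \sigma_1 has cycle type (2k-1, 1), i.e. one (2k-1)-cycle and one fixed point, \sigma_2 has cycle type (3, 2, \ldots, 2, 1) consisting of one 3-cycle, k-2 transpositions and one fixed point, and \sigma_3 is a fixed-point-free involution with cycle type (2, \ldots, 2) consisting of k transpositions, equals 1. -/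
open Equiv Equiv.Perm in
/-- Cycle types are preserved by relabelling the letters. -/
theorem cycleType_permCongr {α β : Type*} [Fintype α] [DecidableEq α] [Fintype β]
    [DecidableEq β] (e : α ≃ β) (σ : Perm α) : (e.permCongr σ).cycleType = σ.cycleType := by
  let f : α ≃ {b : β // True} := e.trans (Equiv.Set.univ β).symm
  rw [← cycleType_extendDomain f (g := σ)]
  congr 1

theorem cycleType_eq_filter_fullCycleType {d : ℕ} (σ : Equiv.Perm (Fin d)) :
    σ.cycleType = (fullCycleType σ).filter (2 ≤ ·) := by
  rw [fullCycleType, Multiset.filter_add,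
    Multiset.filter_eq_self.2 fun _ h => Equiv.Perm.two_le_of_mem_cycleType h,
    Multiset.filter_eq_nil.2, add_zero]
  intro a ha
  rw [Multiset.eq_of_mem_replicate ha]
  omega

namespace PointedCycle

open Equiv Equiv.Perm

variable {n : ℕ}

/-- Translation by `1` on `ZMod n`, fixing the extra point `none`. -/
def rotation (n : ℕ) : Perm (Option (ZMod n)) := optionCongr (Equiv.addRight 1)

/-- Negation on the nonzero elements of `ZMod n`, exchanging `0` with the extra point `none`. -/
def reflection (n : ℕ) : Perm (Option (ZMod n)) :=
  swap none (some 0) * optionCongr (Equiv.neg (ZMod n))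

/-- The permutation `τ` such that `rotation n * τ = reflection n`. -/
def quotient (n : ℕ) : Perm (Option (ZMod n)) := (rotation n)⁻¹ * reflection n

@[simp] theorem rotation_none : rotation n none = none := rfl

@[simp] theorem rotation_some (x : ZMod n) : rotation n (some x) = some (x + 1) := rfl

theorem rotation_inv_some (x : ZMod n) : (rotation n)⁻¹ (some x) = some (x - 1) := by
  rw [Perm.inv_eq_iff_eq, rotation_some, sub_add_cancel]

theorem rotation_pow_none (j : ℕ) : (rotation n ^ j) none = none := by
  induction j with
  | zero => rfl
  | succ j ih => rw [pow_succ', Perm.mul_apply, ih, rotation_none]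

theorem rotation_pow_some (j : ℕ) (x : ZMod n) :
    (rotation n ^ j) (some x) = some (x + j) := by
  induction j with
  | zero => simp
  | succ j ih => rw [pow_succ', Perm.mul_apply, ih, rotation_some]; push_cast; rw [add_assoc]

@[simp] theorem reflection_none : reflection n none = some 0 := by simp [reflection]

@[simp] theorem reflection_zero : reflection n (some 0) = none := by simp [reflection]

theorem reflection_some {x : ZMod n} (hx : x ≠ 0) : reflection n (some x) = some (-x) := by
  rw [reflection, Perm.mul_apply]
  exact swap_apply_of_ne_of_ne (by simp) (by simpa using hx)

@[simp] theorem quotient_none : quotient n none = some (-1) := by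
  rw [quotient, Perm.mul_apply, reflection_none, rotation_inv_some, zero_sub]

@[simp] theorem quotient_zero : quotient n (some 0) = none := by
  rw [quotient, Perm.mul_apply, reflection_zero, Perm.inv_eq_iff_eq, rotation_none]

theorem quotient_some {x : ZMod n} (hx : x ≠ 0) : quotient n (some x) = some (-x - 1) := by
  rw [quotient, Perm.mul_apply, reflection_some hx, rotation_inv_some]

theorem quotient_neg_one [Nontrivial (ZMod n)] : quotient n (some (-1)) = some 0 := by
  simp [quotient_some (neg_ne_zero.2 (one_ne_zero (α := ZMod n)))]

theorem quotient_quotient {x : ZMod n} (h0 : x ≠ 0) (h1 : x ≠ -1) :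
    quotient n (quotient n (some x)) = some x := by
  rw [quotient_some h0, quotient_some]
  · simp
  · intro h
    exact h1 (by linear_combination -h)

/-- Away from at most one orbit of length three, `σ` is an involution. -/
def IsThreeCycleByInvolution {α : Type*} (σ : Perm α) : Prop :=
  ∀ z, σ (σ z) ≠ z →
    σ (σ (σ z)) = z ∧ ∀ y, y = z ∨ y = σ z ∨ y = σ (σ z) ∨ σ (σ y) = y

theorem IsThreeCycleByInvolution.of_isConj {α : Type*} {σ τ : Perm α}
    (h : IsThreeCycleByInvolution σ) (hc : IsConj σ τ) : IsThreeCycleByInvolution τ := by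
  obtain ⟨c, rfl⟩ := isConj_iff.1 hc
  intro z hz
  obtain ⟨z, rfl⟩ := c.surjective z
  have := h z (fun h' => hz (by simp [h']))
  refine ⟨by simp [this.1], fun y => ?_⟩
  obtain ⟨y, rfl⟩ := c.surjective y
  simpa using this.2 y

theorem isThreeCycleByInvolution_quotient [Nontrivial (ZMod n)] :
    IsThreeCycleByInvolution (quotient n) := by
  have key : ∀ y : Option (ZMod n), y = none ∨ y = some 0 ∨ y = some (-1) ∨
      quotient n (quotient n y) = y := by
    rintro (_ | y)
    · exact .inl rfl
    · by_cases h0 : y = 0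
      · simp [h0]
      by_cases h1 : y = -1
      · simp [h1]
      exact .inr (.inr (.inr (quotient_quotient h0 h1)))
  intro z hz
  rcases key z with rfl | rfl | rfl | h
  · simp only [quotient_none, quotient_neg_one, quotient_zero, true_and]
    intro y; have := key y; tauto
  · simp only [quotient_none, quotient_neg_one, quotient_zero, true_and]
    intro y; have := key y; tauto
  · simp only [quotient_none, quotient_neg_one, quotient_zero, true_and]
    intro y; have := key y; tauto
  · exact absurd h hz

theorem reflection_reflection (x : Option (ZMod n)) : reflection n (reflection n x) = x := by
  rcases x with _ | x
  · simp
  · by_cases h : x = 0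
    · simp [h]
    · rw [reflection_some h, reflection_some (neg_ne_zero.2 h), neg_neg]

/-- An involution exchanging `none` and `0` whose product with the inverse of `rotation n` is
an involution away from one orbit of length three is equal to `reflection n`. -/
theorem eq_reflection [NeZero n] [Nontrivial (ZMod n)] {ρ : Perm (Option (ZMod n))}
    (hρ : ∀ x, ρ (ρ x) = x) (h0 : ρ none = some 0)
    (hq : IsThreeCycleByInvolution ((rotation n)⁻¹ * ρ)) : ρ = reflection n := by
  have h0' : ρ (some 0) = none := by rw [← h0, hρ]
  have hne : ρ (some (-1)) ≠ none := fun h => by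
    have : some (-1 : ZMod n) = some 0 := by rw [← h0, ← h, hρ]
    simp at this
  obtain ⟨h3, hq⟩ := hq none (by
    simp only [Perm.mul_apply, h0, rotation_inv_some, zero_sub]
    intro h
    rw [Perm.inv_eq_iff_eq, rotation_none] at h
    exact hne h)
  simp only [Perm.mul_apply, h0, rotation_inv_some, zero_sub] at h3 hq
  rw [Perm.inv_eq_iff_eq, rotation_none] at h3
  have h4 : (rotation n)⁻¹ (ρ (some (-1))) = some 0 := by rw [← h0, ← h3, hρ]
  rw [h4] at hq
  have h5 : ρ (some (-1)) = some 1 := by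
    rw [Perm.inv_eq_iff_eq, rotation_some, zero_add] at h4; exact h4
  have main : ∀ j : ℕ, j + 1 < n → ρ (some ((j + 1 : ℕ) : ZMod n)) =
      some (-((j + 1 : ℕ) : ZMod n)) := by
    intro j
    induction j with
    | zero => intro _; simp [← h5, hρ]
    | succ j ih =>
      intro hj
      have ih := ih (by omega)
      have e0 : ((j + 1 : ℕ) : ZMod n) ≠ 0 := by
        rw [Ne, ZMod.natCast_eq_zero_iff]
        exact Nat.not_dvd_of_pos_of_lt (by omega) (by omega)
      have e1 : ((j + 1 : ℕ) : ZMod n) ≠ -1 := by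
        intro h
        have : ((j + 1 + 1 : ℕ) : ZMod n) = 0 := by push_cast at h ⊢; rw [h]; ring
        rw [ZMod.natCast_eq_zero_iff] at this
        exact Nat.not_dvd_of_pos_of_lt (by omega) (by omega) this
      rcases hq (some ((j + 1 : ℕ) : ZMod n)) with h | h | h | h
      · simp at h
      · exact absurd (Option.some.inj h) e1
      · exact absurd (Option.some.inj h) e0
      · rw [ih, rotation_inv_some, Perm.inv_eq_iff_eq, rotation_some] at h
        have h := congrArg ρ h
        rw [hρ] at h
        push_cast at h ⊢
        rw [← h]
        congr 1
        ring
  ext1 x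
  rcases x with _ | x
  · simp [h0]
  by_cases hx : x = 0
  · simp [hx, h0']
  rw [reflection_some hx]
  have hv : x.val ≠ 0 := by simpa [ZMod.val_eq_zero] using hx
  have := main (x.val - 1) (by have := x.val_lt; omega)
  rwa [Nat.sub_add_cancel (by omega), ZMod.natCast_zmod_val] at this

theorem reflection_ne (hn : Odd n) (x : Option (ZMod n)) : reflection n x ≠ x := by
  have := hn.pos
  have : NeZero n := ⟨by omega⟩
  rcases x with _ | x
  · simp
  · by_cases h : x = 0
    · simp [h]
    · rw [reflection_some h]
      intro h'
      exact ZMod.ne_neg_self hn h (Option.some.inj h').symm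

/-- Up to simultaneous conjugation, `(rotation n, quotient n, reflection n)` is the only
factorization with these conjugacy classes. -/
theorem exists_conj [Nontrivial (ZMod n)] (hn : Odd n) {σ₁ σ₂ σ₃ : Perm (Option (ZMod n))}
    (hmul : σ₁ * σ₂ = σ₃) (h₁ : IsConj (rotation n) σ₁) (h₂ : IsConj (quotient n) σ₂)
    (h₃ : IsConj (reflection n) σ₃) :
    ∃ τ, σ₁ = τ * rotation n * τ⁻¹ ∧ σ₂ = τ * quotient n * τ⁻¹ := by
  have := hn.pos
  have : NeZero n := ⟨by omega⟩
  obtain ⟨c, rfl⟩ := isConj_iff.1 h₁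
  obtain ⟨d, rfl⟩ := isConj_iff.1 h₃
  obtain ⟨a, ha⟩ : ∃ a, (c⁻¹ * (d * reflection n * d⁻¹) * c) none = some a := by
    rw [← Option.ne_none_iff_exists']
    intro h
    rw [Perm.mul_apply, Perm.mul_apply, Perm.inv_eq_iff_eq, Perm.mul_apply, Perm.mul_apply,
      ← Perm.eq_inv_iff_eq] at h
    exact reflection_ne hn _ h
  set τ := c * rotation n ^ a.val with hτ
  have hrot : c * rotation n * c⁻¹ = τ * rotation n * τ⁻¹ := by
    rw [hτ]; group
  have hσ : σ₂ = τ * ((rotation n)⁻¹ * (τ⁻¹ * (d * reflection n * d⁻¹) * τ)) * τ⁻¹ := by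
    rw [← hmul, hrot]; group
  have href : τ⁻¹ * (d * reflection n * d⁻¹) * τ = reflection n := by
    apply eq_reflection
    · intro x
      obtain ⟨y, rfl⟩ := (τ⁻¹ * d).surjective x
      simp [reflection_reflection]
    · have : τ⁻¹ * (d * reflection n * d⁻¹) * τ = (rotation n ^ a.val)⁻¹ *
          (c⁻¹ * (d * reflection n * d⁻¹) * c) * rotation n ^ a.val := by
        rw [hτ]; group
      rw [this, Perm.mul_apply, rotation_pow_none, Perm.mul_apply, ha, Perm.inv_eq_iff_eq,
        rotation_pow_some, zero_add, ZMod.natCast_zmod_val]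
    · refine isThreeCycleByInvolution_quotient.of_isConj (h₂.trans ?_)
      exact (isConj_iff.2 ⟨τ, hσ.symm⟩).symm
  exact ⟨τ, hrot, by rw [hσ, href, quotient]⟩

theorem cycleType_eq_replicate_two {α : Type*} [Fintype α] [DecidableEq α] {σ : Perm α}
    {m : ℕ} (h : ∀ x, σ (σ x) = x) (hm : σ.support.card = 2 * m) :
    σ.cycleType = Multiset.replicate m 2 := by
  have h2 := pow_prime_eq_one_iff.1 (show σ ^ 2 = 1 by ext1 x; simp [pow_two, h])
  have := Multiset.eq_replicate_of_mem h2
  have hs := σ.sum_cycleType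
  rw [this, Multiset.sum_replicate, hm, smul_eq_mul] at hs
  rw [this]
  congr 1
  omega

theorem cycleType_rotation [NeZero n] [Nontrivial (ZMod n)] :
    (rotation n).cycleType = {n} := by
  have hs : (rotation n).support = Finset.univ.erase none := by
    ext x
    rcases x with _ | x <;> simp
  have hc : (rotation n).IsCycle := by
    refine ⟨some 0, by simp, ?_⟩
    rintro (_ | y) hy
    · simp at hy
    · exact ⟨y.val, by rw [zpow_natCast, rotation_pow_some, zero_add, ZMod.natCast_zmod_val]⟩
  rw [hc.cycleType, hs, Finset.card_erase_of_mem (Finset.mem_univ _), Finset.card_univ,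
    Fintype.card_option, ZMod.card, Nat.add_sub_cancel]

theorem cycleType_reflection {m : ℕ} :
    (reflection (2 * m + 1)).cycleType = Multiset.replicate (m + 1) 2 := by
  apply cycleType_eq_replicate_two reflection_reflection
  have : (reflection (2 * m + 1)).support = Finset.univ := by
    ext x
    simpa using reflection_ne (odd_two_mul_add_one m) x
  rw [this, Finset.card_univ, Fintype.card_option, ZMod.card]
  ring

theorem cycleType_quotient {m : ℕ} (hm : 1 ≤ m) :
    (quotient (2 * m + 1)).cycleType = 3 ::ₘ Multiset.replicate (m - 1) 2 := by
  have : Fact (1 < 2 * m + 1) := ⟨by omega⟩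
  let h : ZMod (2 * m + 1) := m
  have hh : 2 * h + 1 = 0 := by
    have := ZMod.natCast_self (2 * m + 1)
    push_cast at this
    exact this
  have hfix (x : ZMod (2 * m + 1)) : -x - 1 = x ↔ x = h := by
    constructor
    · intro hx
      linear_combination h * hx + x * hh
    · rintro rfl
      linear_combination -hh
  have h0 : h ≠ 0 := by rintro h'; simp [h'] at hh
  have h1 : h ≠ -1 := by
    rintro h'
    rw [h'] at hh
    exact one_ne_zero (α := ZMod (2 * m + 1)) (by linear_combination -hh)
  let D : Perm (Option (ZMod (2 * m + 1))) := swap none (some 0) * swap none (some (-1))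
  let T : Perm (Option (ZMod (2 * m + 1))) := D⁻¹ * quotient (2 * m + 1)
  have hD : D.IsThreeCycle := isThreeCycle_swap_mul_swap_same (by simp) (by simp) (by simp)
  have Dn : D none = some (-1) := by
    rw [Perm.mul_apply, swap_apply_left, swap_apply_of_ne_of_ne (by simp) (by simp)]
  have D0 : D (some 0) = none := by
    rw [Perm.mul_apply, swap_apply_of_ne_of_ne (x := some 0) (by simp) (by simp),
      swap_apply_right]
  have D1 : D (some (-1)) = some 0 := by
    rw [Perm.mul_apply, swap_apply_right, swap_apply_left]
  have Dx {x : ZMod (2 * m + 1)} (hx0 : x ≠ 0) (hx1 : x ≠ -1) : D (some x) = some x := by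
    rw [Perm.mul_apply, swap_apply_of_ne_of_ne (x := some x) (by simp) (by simpa using hx1),
      swap_apply_of_ne_of_ne (by simp) (by simpa using hx0)]
  have Tn : T none = none := by
    rw [Perm.mul_apply, Perm.inv_eq_iff_eq, Dn, quotient_none]
  have T0 : T (some 0) = some 0 := by
    rw [Perm.mul_apply, Perm.inv_eq_iff_eq, D0, quotient_zero]
  have T1 : T (some (-1)) = some (-1) := by
    rw [Perm.mul_apply, Perm.inv_eq_iff_eq, D1, quotient_neg_one]
  have ne0 {x : ZMod (2 * m + 1)} (hx1 : x ≠ -1) : -x - 1 ≠ 0 :=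
    fun h' => hx1 (by linear_combination -h')
  have ne1 {x : ZMod (2 * m + 1)} (hx0 : x ≠ 0) : -x - 1 ≠ -1 :=
    fun h' => hx0 (by linear_combination -h')
  have Tx {x : ZMod (2 * m + 1)} (hx0 : x ≠ 0) (hx1 : x ≠ -1) :
      T (some x) = some (-x - 1) := by
    rw [Perm.mul_apply, Perm.inv_eq_iff_eq, quotient_some hx0, Dx (ne0 hx1) (ne1 hx0)]
  have hTT : ∀ x, T (T x) = x := by
    rintro (_ | x)
    · rw [Tn, Tn]
    by_cases hx0 : x = 0
    · rw [hx0, T0, T0]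
    by_cases hx1 : x = -1
    · rw [hx1, T1, T1]
    rw [Tx hx0 hx1, Tx (ne0 hx1) (ne1 hx0)]
    congr 1
    ring
  have hT : T.support = ({none, some 0, some (-1), some h} : Finset _)ᶜ := by
    ext x
    rw [mem_support, Finset.mem_compl]
    apply not_congr
    rcases x with _ | x
    · simp [Tn]
    by_cases hx0 : x = 0
    · simp [hx0, T0]
    by_cases hx1 : x = -1
    · simp [hx1, T1]
    rw [Tx hx0 hx1, Option.some_inj, hfix]
    simp [hx0, hx1]
  have hcard : T.support.card = 2 * (m - 1) := by
    have : ({none, some 0, some (-1), some h} : Finset (Option (ZMod (2 * m + 1)))).card = 4 := by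
      rw [Finset.card_insert_of_notMem, Finset.card_insert_of_notMem,
        Finset.card_insert_of_notMem, Finset.card_singleton]
      · simpa using h1.symm
      · simpa using h0.symm
      · simp
    rw [hT, Finset.card_compl, this, Fintype.card_option, ZMod.card]
    omega
  have hdisj : Disjoint D T := by
    rintro (_ | x)
    · exact .inr Tn
    by_cases hx0 : x = 0
    · exact .inr (hx0 ▸ T0)
    by_cases hx1 : x = -1
    · exact .inr (hx1 ▸ T1)
    exact .inl (Dx hx0 hx1)
  have hDT : quotient (2 * m + 1) = D * T := (mul_inv_cancel_left _ _).symm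
  rw [hDT, hdisj.cycleType_mul, hD.cycleType, cycleType_eq_replicate_two hTT hcard]
  rfl

end PointedCycle

theorem fullCycleType_permCongr {α : Type*} [Fintype α] [DecidableEq α] {d : ℕ}
    (e : α ≃ Fin d) (σ : Equiv.Perm α) : fullCycleType (e.permCongr σ) =
      σ.cycleType + Multiset.replicate (d - σ.cycleType.sum) 1 := by
  rw [fullCycleType, cycleType_permCongr]

namespace PointedCycle

open Equiv Equiv.Perm

theorem isTransitivePair_permCongr {n d : ℕ} [NeZero n] (e : Option (ZMod n) ≃ Fin d) :
    IsTransitivePair (e.permCongr (rotation n)) (e.permCongr (quotient n)) := by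
  set H := Subgroup.closure
    ({e.permCongr (rotation n), e.permCongr (quotient n)} : Set (Perm (Fin d))) with hH
  have hr : e.permCongr (rotation n) ∈ H := Subgroup.subset_closure (by simp)
  have hq : e.permCongr (quotient n) ∈ H := Subgroup.subset_closure (by simp)
  have key : ∀ x, ∃ τ ∈ H, τ (e (some 0)) = e x := by
    rintro (_ | x)
    · exact ⟨_, hq, by simp⟩
    · refine ⟨_, H.pow_mem hr x.val, ?_⟩
      rw [← permCongrHom_coe, ← map_pow, permCongrHom_coe, permCongr_apply, symm_apply_apply,
        rotation_pow_some, zero_add, ZMod.natCast_zmod_val]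
  intro x y
  obtain ⟨a, ha, hax⟩ := key (e.symm x)
  obtain ⟨b, hb, hby⟩ := key (e.symm y)
  refine ⟨b * a⁻¹, H.mul_mem hb (H.inv_mem ha), ?_⟩
  rw [apply_symm_apply] at hax hby
  rw [Perm.mul_apply, ← hax, ← Perm.mul_apply, ← Perm.mul_apply, inv_mul_cancel_right, hby]

theorem permCongr_mem_hurwitzTriples {m : ℕ} (hm : 1 ≤ m)
    (e : Option (ZMod (2 * m + 1)) ≃ Fin (2 * (m + 1))) :
    (e.permCongr (rotation _), e.permCongr (quotient _), e.permCongr (reflection _)) ∈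
      HurwitzTriples (2 * (m + 1)) {2 * (m + 1) - 1, 1}
        (3 ::ₘ (Multiset.replicate (m + 1 - 2) 2 + {1})) (Multiset.replicate (m + 1) 2) := by
  have : Fact (1 < 2 * m + 1) := ⟨by omega⟩
  refine ⟨?_, ?_, ?_, ?_, isTransitivePair_permCongr e⟩
  · rw [← permCongr_mul, quotient, mul_inv_cancel_left]
  · rw [fullCycleType_permCongr, cycleType_rotation, Multiset.sum_singleton,
      show 2 * (m + 1) - (2 * m + 1) = 1 by omega]
    rfl
  · rw [fullCycleType_permCongr, cycleType_quotient hm, Multiset.sum_cons,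
      Multiset.sum_replicate, smul_eq_mul,
      show 2 * (m + 1) - (3 + (m - 1) * 2) = 1 by omega, Multiset.cons_add]
    rfl
  · rw [fullCycleType_permCongr, cycleType_reflection, Multiset.sum_replicate, smul_eq_mul,
      show 2 * (m + 1) - (m + 1) * 2 = 0 by omega, Multiset.replicate_zero, add_zero]

theorem exists_eq_permCongr {m : ℕ} (hm : 1 ≤ m)
    (e : Option (ZMod (2 * m + 1)) ≃ Fin (2 * (m + 1)))
    {p : Perm (Fin (2 * (m + 1))) × Perm (Fin (2 * (m + 1))) × Perm (Fin (2 * (m + 1)))}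
    (hp : p ∈ HurwitzTriples (2 * (m + 1)) {2 * (m + 1) - 1, 1}
      (3 ::ₘ (Multiset.replicate (m + 1 - 2) 2 + {1})) (Multiset.replicate (m + 1) 2)) :
    ∃ f : Option (ZMod (2 * m + 1)) ≃ Fin (2 * (m + 1)), p =
      (f.permCongr (rotation _), f.permCongr (quotient _), f.permCongr (reflection _)) := by
  have : Fact (1 < 2 * m + 1) := ⟨by omega⟩
  obtain ⟨σ₁, σ₂, σ₃⟩ := p
  have hmodel := permCongr_mem_hurwitzTriples hm e
  obtain ⟨-, m₁, m₂, m₃, -⟩ := hmodel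
  obtain ⟨hmul, h₁, h₂, h₃, -⟩ := hp
  have conj {σ : Perm (Option (ZMod (2 * m + 1)))} {ρ : Perm (Fin (2 * (m + 1)))}
      (h : fullCycleType (e.permCongr σ) = fullCycleType ρ) :
      IsConj σ (e.symm.permCongr ρ) := by
    rw [isConj_iff_cycleType_eq, cycleType_permCongr, cycleType_eq_filter_fullCycleType ρ, ← h,
      ← cycleType_eq_filter_fullCycleType, cycleType_permCongr]
  obtain ⟨τ, hτ₁, hτ₂⟩ := exists_conj (odd_two_mul_add_one m)
    (by rw [← permCongr_mul, hmul]) (conj (m₁.trans h₁.symm)) (conj (m₂.trans h₂.symm))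
    (conj (m₃.trans h₃.symm))
  have hf₁ : σ₁ = (τ.trans e).permCongr (rotation _) := by
    rw [← permCongr_symm, symm_apply_eq] at hτ₁
    exact hτ₁
  have hf₂ : σ₂ = (τ.trans e).permCongr (quotient _) := by
    rw [← permCongr_symm, symm_apply_eq] at hτ₂
    exact hτ₂
  refine ⟨τ.trans e, Prod.ext hf₁ (Prod.ext hf₂ ?_)⟩
  refine hmul.symm.trans ?_
  dsimp only
  rw [hf₁, hf₂, ← permCongr_mul, quotient, mul_inv_cancel_left]

end PointedCycle

/-- Proposition 2.3, row 6: for `k ≥ 2`, the number of simultaneous-conjugacy classes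
of transitive triples `(σ₁, σ₂, σ₃)` in `S_{2k}` with `σ₁σ₂ = σ₃`, `σ₁` of cycle type
`(2k-1, 1)`, `σ₂` of cycle type `(3, 2, …, 2, 1)` and `σ₃` a fixed-point-free involution
equals `1`. -/
theorem hurwitz_count_row6 (k : ℕ) (hk : 2 ≤ k) :
    Nat.card (Quot (SimConj
      (HurwitzTriples (2 * k) {2 * k - 1, 1} (3 ::ₘ (Multiset.replicate (k - 2) 2 + {1}))
        (Multiset.replicate k 2)))) = 1 := by
  obtain ⟨m, rfl⟩ : ∃ m, k = m + 1 := ⟨k - 1, by omega⟩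
  have hm : 1 ≤ m := by omega
  let e : Option (ZMod (2 * m + 1)) ≃ Fin (2 * (m + 1)) := Fintype.equivOfCardEq (by
    rw [Fintype.card_option, ZMod.card, Fintype.card_fin]; ring)
  rw [Nat.card_eq_one_iff_unique]
  refine ⟨⟨?_⟩, ⟨Quot.mk _ ⟨_, PointedCycle.permCongr_mem_hurwitzTriples hm e⟩⟩⟩
  rintro ⟨p, hp⟩ ⟨q, hq⟩
  obtain ⟨f, rfl⟩ := PointedCycle.exists_eq_permCongr hm e hp
  obtain ⟨g, rfl⟩ := PointedCycle.exists_eq_permCongr hm e hq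
  apply Quot.sound
  have key (σ : Equiv.Perm (Option (ZMod (2 * m + 1)))) :
      g.permCongr σ = f.symm.trans g * f.permCongr σ * (f.symm.trans g)⁻¹ := by
    rw [eq_mul_inv_iff_mul_eq]
    ext1 x
    simp
  exact ⟨f.symm.trans g, key _, key _, key _⟩
end

section
/- Let k \ge 3 be an integer. The number of simultaneous-conjugacy classes of transitive triples (\sigma_1, \sigma_2, \sigma_3) in S_{2k} with \sigma_1 \circ \sigma_2 = \sigma_3 such that \sigma_1 has cycle type (2k-1, 1), i.e. one (2k-1)-cycle and one fixed point, \sigma_2 has cycle type (4, 2, \ldots, 2, 1, 1) consisting of one 4-cycle, k-3 transpositions and two fixed points, and \sigma_3 is a fixed-point-free involution with cycle type (2, \ldots, 2) consisting of k transpositions, equals k-2. -/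
open Equiv Equiv.Perm

theorem fullCycleType_eq_iff {d c : ℕ} (σ : Perm (Fin d)) {M : Multiset ℕ}
    (hM : ∀ x ∈ M, 2 ≤ x) (hd : M.sum + c = d) :
    fullCycleType σ = M + Multiset.replicate c 1 ↔ σ.cycleType = M := by
  constructor
  · intro h
    have h' := congrArg (Multiset.filter (2 ≤ ·)) h
    unfold fullCycleType at h'
    rw [Multiset.filter_add, Multiset.filter_add,
      Multiset.filter_eq_self.2 fun x hx => two_le_of_mem_cycleType hx,
      Multiset.filter_eq_self.2 hM,
      Multiset.filter_eq_nil.2 fun x hx => by simp [Multiset.eq_of_mem_replicate hx],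
      Multiset.filter_eq_nil.2 fun x hx => by simp [Multiset.eq_of_mem_replicate hx]] at h'
    simpa using h'
  · intro h
    rw [fullCycleType, h]
    congr 2
    omega

theorem cycleType_eq_replicate_two_of_sq_eq_one {α : Type*} [Fintype α] [DecidableEq α]
    {σ : Perm α} (h : σ ^ 2 = 1) : ∃ n, σ.cycleType = Multiset.replicate n 2 := by
  refine ⟨σ.cycleType.card, Multiset.eq_replicate_card.2 fun n hn => ?_⟩
  have h2 := two_le_of_mem_cycleType hn
  have h3 := Nat.le_of_dvd two_pos ((dvd_of_mem_cycleType hn).trans (orderOf_dvd_of_pow_eq_one h))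
  omega

theorem sq_eq_one_of_cycleType_eq_replicate_two {α : Type*} [Fintype α] [DecidableEq α]
    {σ : Perm α} {n : ℕ} (h : σ.cycleType = Multiset.replicate n 2) : σ ^ 2 = 1 := by
  rw [← orderOf_dvd_iff_pow_eq_one, ← lcm_cycleType, h, Multiset.lcm_dvd]
  intro b hb
  rw [Multiset.eq_of_mem_replicate hb]

theorem cycleType_eq_replicate_two_iff {k : ℕ} (σ : Perm (Fin (2 * k))) :
    σ.cycleType = Multiset.replicate k 2 ↔ ∀ x, σ (σ x) = x ∧ σ x ≠ x := by
  constructor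
  · intro h x
    refine ⟨DFunLike.congr_fun (sq_eq_one_of_cycleType_eq_replicate_two h) x, ?_⟩
    have h1 : σ.support.card = 2 * k := by
      rw [← sum_cycleType, h]; simp [mul_comm]
    have h2 : σ.support = Finset.univ := by
      rw [← Finset.card_eq_iff_eq_univ, h1, Fintype.card_fin]
    exact mem_support.1 (h2 ▸ Finset.mem_univ x)
  · intro h
    obtain ⟨n, hn⟩ := cycleType_eq_replicate_two_of_sq_eq_one (σ := σ) (Equiv.ext fun x => (h x).1)
    have h2 : σ.support = Finset.univ := by
      ext x; simp [(h x).2]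
    have h3 := sum_cycleType σ
    rw [hn, h2] at h3
    simp at h3
    rw [hn, show n = k by omega]

theorem mem_orbit_of_sameCycle_of_pow_four {α : Type*} [Finite α] {σ : Perm α} {x y : α}
    (h : σ.SameCycle x y) (h4 : (σ ^ 4) x = x) :
    y = x ∨ y = σ x ∨ y = σ (σ x) ∨ y = σ (σ (σ x)) := by
  obtain ⟨i, -, rfl⟩ := h.exists_pow_eq'
  have hi : (σ ^ i) x = (σ ^ (i % 4)) x := by
    conv_lhs => rw [← Nat.mod_add_div i 4, pow_add, pow_mul, mul_apply]
    congr 1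
    exact pow_apply_eq_self_of_apply_eq_self h4 _
  rw [hi]
  have : i % 4 < 4 := Nat.mod_lt _ (by norm_num)
  interval_cases i % 4 <;> simp [pow_succ]

theorem cycleType_eq_cycleType_cycleOf_add {α : Type*} [Fintype α] [DecidableEq α]
    {σ : Perm α} {x : α} (hx : σ x ≠ x) :
    σ.cycleType = (σ.cycleOf x).support.card ::ₘ (σ * (σ.cycleOf x)⁻¹).cycleType := by
  have hd := disjoint_mul_inv_of_mem_cycleFactorsFinset
    (cycleOf_mem_cycleFactorsFinset_iff.2 (mem_support.2 hx))
  have h := hd.cycleType_mul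
  rw [inv_mul_cancel_right, (isCycle_cycleOf σ hx).cycleType, add_comm] at h
  simpa using h

theorem sq_apply_mul_inv_cycleOf {α : Type*} [Fintype α] [DecidableEq α]
    {σ : Perm α} {x y : α} (hx : σ x ≠ x) (hy : ¬ σ.SameCycle x y) :
    ((σ * (σ.cycleOf x)⁻¹) ^ 2) y = σ (σ y) := by
  have hd := disjoint_mul_inv_of_mem_cycleFactorsFinset
    (cycleOf_mem_cycleFactorsFinset_iff.2 (mem_support.2 hx))
  have h := hd.commute.mul_pow 2
  rw [inv_mul_cancel_right] at h
  have h' := DFunLike.congr_fun h y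
  have hc : ((σ.cycleOf x) ^ 2) y = y :=
    pow_apply_eq_self_of_apply_eq_self (cycleOf_apply_of_not_sameCycle hy) 2
  rw [mul_apply, hc] at h'
  exact h'.symm

theorem card_support_cycleOf_eq_four {α : Type*} [Fintype α] [DecidableEq α]
    {σ : Perm α} {x : α} (hx : σ x ≠ x) (hx2 : σ (σ x) ≠ x) (h4 : (σ ^ 4) x = x) :
    (σ.cycleOf x).support.card = 4 := by
  have hc := isCycle_cycleOf σ hx
  have hx' : σ.cycleOf x x ≠ x := by rwa [cycleOf_apply_self]
  rw [← hc.orderOf]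
  refine orderOf_eq_prime_pow (p := 2) (n := 1) ?_ ?_
  · rw [hc.pow_eq_one_iff' hx', cycleOf_pow_apply_self]
    exact hx2
  · rw [hc.pow_eq_one_iff' hx', cycleOf_pow_apply_self]
    exact h4

theorem of_cycleType_eq_four_cons {α : Type*} [Fintype α] [DecidableEq α]
    {σ : Perm α} {a : ℕ} (h : σ.cycleType = 4 ::ₘ Multiset.replicate a 2) {x : α}
    (hx : σ x ≠ x) (hx2 : σ (σ x) ≠ x) :
    (σ ^ 4) x = x ∧
      ∀ y, y ≠ x → y ≠ σ x → y ≠ σ (σ x) → y ≠ σ (σ (σ x)) → σ (σ y) = y := by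
  have hc := isCycle_cycleOf σ hx
  have hx' : σ.cycleOf x x ≠ x := by rwa [cycleOf_apply_self]
  have hct := cycleType_eq_cycleType_cycleOf_add hx
  rw [h] at hct
  have hcard : (σ.cycleOf x).support.card = 4 := by
    have hm : (σ.cycleOf x).support.card ∈ 4 ::ₘ Multiset.replicate a 2 := by
      rw [hct]; exact Multiset.mem_cons_self _ _
    rcases Multiset.mem_cons.1 hm with hm | hm
    · exact hm
    · have h2 := Multiset.eq_of_mem_replicate hm
      refine absurd ?_ hx2
      have : (σ.cycleOf x) ^ 2 = 1 := by rw [← h2, ← hc.orderOf, pow_orderOf_eq_one]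
      rw [hc.pow_eq_one_iff' hx', cycleOf_pow_apply_self] at this
      exact this
  have h4 : (σ ^ 4) x = x := by
    rw [← cycleOf_pow_apply_self, ← hcard, ← hc.orderOf, pow_orderOf_eq_one, one_apply]
  refine ⟨h4, fun y h0 h1 h2 h3 => ?_⟩
  have hns : ¬ σ.SameCycle x y := fun hs => by
    rcases mem_orbit_of_sameCycle_of_pow_four hs h4 with h | h | h | h <;> contradiction
  rw [hcard, Multiset.cons_inj_right] at hct
  rw [← sq_apply_mul_inv_cycleOf hx hns,
    sq_eq_one_of_cycleType_eq_replicate_two hct.symm, one_apply]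

theorem cycleType_eq_four_cons {α : Type*} [Fintype α] [DecidableEq α]
    {σ : Perm α} {a : ℕ} (hcard : Fintype.card α = 2 * a + 6) {x : α}
    (hx : σ x ≠ x) (hx2 : σ (σ x) ≠ x) (h4 : (σ ^ 4) x = x)
    (hinv : ∀ y, y ≠ x → y ≠ σ x → y ≠ σ (σ x) → y ≠ σ (σ (σ x)) → σ (σ y) = y)
    {p q : α} (hpq : p ≠ q) (hfix : ∀ y, σ y = y ↔ y = p ∨ y = q) :
    σ.cycleType = 4 ::ₘ Multiset.replicate a 2 := by
  have hct := cycleType_eq_cycleType_cycleOf_add hx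
  rw [card_support_cycleOf_eq_four hx hx2 h4] at hct
  have hr : (σ * (σ.cycleOf x)⁻¹) ^ 2 = 1 := by
    ext y
    by_cases hs : σ.SameCycle x y
    · have hd := disjoint_mul_inv_of_mem_cycleFactorsFinset
        (cycleOf_mem_cycleFactorsFinset_iff.2 (mem_support.2 hx))
      have hy : σ.cycleOf x y ≠ y := by
        rw [hs.cycleOf_apply]
        exact fun h => hx (hs.apply_eq_self_iff.2 h)
      exact pow_apply_eq_self_of_apply_eq_self ((hd y).resolve_right hy) 2
    · rw [sq_apply_mul_inv_cycleOf hx hs, one_apply]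
      refine hinv y ?_ ?_ ?_ ?_ <;> rintro rfl <;> apply hs <;> simp [SameCycle.refl]
  obtain ⟨n, hn⟩ := cycleType_eq_replicate_two_of_sq_eq_one hr
  rw [hn] at hct
  have hsup : σ.supportᶜ = {p, q} := by
    ext y; simp only [Finset.mem_compl, mem_support, not_not, hfix, Finset.mem_insert,
      Finset.mem_singleton]
  have h1 := Finset.card_compl σ.support
  have h2 := sum_cycleType σ
  have h3 := Finset.card_le_univ σ.support
  rw [hsup, Finset.card_pair hpq] at h1
  rw [hct] at h2
  simp at h2
  rw [hct, show n = a by omega]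

/-- The `(2m+1)`-cycle `x ↦ x + 1` on `{0, …, 2m}`, fixing the last letter `2m + 1`. -/
def fixLastCycle (m : ℕ) : Perm (Fin (2 * (m + 1))) :=
  Fin.cycleRange ⟨2 * m, by omega⟩

theorem fixLastCycle_val {m : ℕ} (x : Fin (2 * (m + 1))) :
    (fixLastCycle m x : ℕ) = if (x : ℕ) = 2 * m then 0 else if (x : ℕ) = 2 * m + 1 then 2 * m + 1
      else x + 1 := by
  unfold fixLastCycle
  have hx := x.2
  by_cases h : x ≤ ⟨2 * m, by omega⟩
  · rw [Fin.coe_cycleRange_of_le h]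
    rw [Fin.le_def] at h
    simp only [Fin.ext_iff]
    grind
  · rw [Fin.cycleRange_of_gt (not_le.1 h)]
    rw [Fin.le_def] at h
    grind

/-- The values of the inverse of `fixLastCycle m`. -/
def predFun (m x : ℕ) : ℕ :=
  if x = 0 then 2 * m else if x = 2 * m + 1 then 2 * m + 1 else x - 1

theorem fixLastCycle_inv_val {m : ℕ} (x : Fin (2 * (m + 1))) :
    ((fixLastCycle m)⁻¹ x : ℕ) = predFun m x := by
  have h := fixLastCycle_val ((fixLastCycle m)⁻¹ x)
  rw [show fixLastCycle m ((fixLastCycle m)⁻¹ x) = x from (fixLastCycle m).apply_symm_apply x] at h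
  have := ((fixLastCycle m)⁻¹ x).2
  have := x.2
  grind [predFun]

theorem cycleType_fixLastCycle {m : ℕ} (hm : 0 < m) : (fixLastCycle m).cycleType = {2 * m + 1} := by
  have : NeZero (2 * (m + 1)) := ⟨by omega⟩
  unfold fixLastCycle
  rw [Fin.cycleType_cycleRange]
  simp [Fin.ext_iff]
  omega

/-- The values of the matching pairing `0` with `2m + 1`, reversing `{1, …, j}` and reversing
`{j + 1, …, 2m}`. -/
def matchingFun (m j x : ℕ) : ℕ :=
  if x = 0 then 2 * m + 1 else if x = 2 * m + 1 then 0 else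
    if x ≤ j then j + 1 - x else 2 * m + 1 + j - x

/-- The fixed-point-free involution with values `matchingFun m (2 * (i + 1))`. -/
def matching {m : ℕ} (i : Fin (m - 1)) : Perm (Fin (2 * (m + 1))) :=
  Function.Involutive.toPerm
    (fun x => ⟨matchingFun m (2 * (i + 1)) x, by have := x.2; grind [matchingFun]⟩)
    (fun x => by ext; have := x.2; have := i.2; grind [matchingFun])

theorem matching_val {m : ℕ} (i : Fin (m - 1)) (x : Fin (2 * (m + 1))) :
    (matching i x : ℕ) = matchingFun m (2 * (i + 1)) x := rfl

theorem matching_involutive_fixedPointFree {m : ℕ} (i : Fin (m - 1)) (x : Fin (2 * (m + 1))) :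
    matching i (matching i x) = x ∧ matching i x ≠ x := by
  have := x.2
  have := i.2
  simp only [ne_eq, Fin.ext_iff, matching_val]
  grind [matchingFun]

theorem predFun_matchingFun {m j x : ℕ} (hj : j ≤ 2 * m) (hx : x < 2 * m + 2) :
    predFun m (matchingFun m j x) = if x = 0 then 2 * m + 1 else if x = 2 * m + 1 then 2 * m else
      if x ≤ j then j - x else 2 * m + j - x := by
  unfold matchingFun predFun
  grind

theorem cycleType_fixLastCycle_inv_mul_matching {m : ℕ} (i : Fin (m - 1)) :
    ((fixLastCycle m)⁻¹ * matching i).cycleType = 4 ::ₘ Multiset.replicate (m - 2) 2 := by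
  have hi := i.2
  set φ := (fixLastCycle m)⁻¹ * matching i
  have hφ (x : Fin (2 * (m + 1))) : (φ x : ℕ) = if (x : ℕ) = 0 then 2 * m + 1 else
      if (x : ℕ) = 2 * m + 1 then 2 * m else if (x : ℕ) ≤ 2 * (i + 1) then 2 * (i + 1) - x
      else 2 * m + 2 * (i + 1) - x := by
    rw [← predFun_matchingFun (by omega) (by omega), ← matching_val, ← fixLastCycle_inv_val]
    rfl
  have h1 : φ ⟨0, by omega⟩ = ⟨2 * m + 1, by omega⟩ := by ext; rw [hφ]; simp
  have h2 : φ ⟨2 * m + 1, by omega⟩ = ⟨2 * m, by omega⟩ := by ext; rw [hφ]; simp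
  have h3 : φ ⟨2 * m, by omega⟩ = ⟨2 * (i + 1), by omega⟩ := by ext; rw [hφ]; grind
  have h4 : φ ⟨2 * (i + 1), by omega⟩ = ⟨0, by omega⟩ := by ext; rw [hφ]; grind
  refine cycleType_eq_four_cons (x := ⟨0, by omega⟩) (p := ⟨i + 1, by omega⟩)
    (q := ⟨m + (i + 1), by omega⟩) (by simp; omega) ?_ ?_ ?_ ?_ ?_ ?_ <;>
  simp only [pow_succ, pow_zero, one_mul, mul_apply, h1, h2, h3, h4, ne_eq, Fin.ext_iff, hφ]
  · omega
  · omega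
  · intro y
    have := y.2
    grind
  · omega
  · intro y
    have := y.2
    grind

theorem exists_eq_matchingFun {m : ℕ} {T : ℕ → ℕ}
    (hlt : ∀ x < 2 * m + 2, T x < 2 * m + 2) (hTT : ∀ x < 2 * m + 2, T (T x) = x ∧ T x ≠ x)
    (hm : 0 < m) (h0 : T 0 = 2 * m + 1) (h1 : T (2 * m + 1) = 0)
    (h4 : predFun m (T (predFun m (T (2 * m)))) = 0)
    (hinv : ∀ x < 2 * m + 2, x ≠ 0 → x ≠ 2 * m + 1 → x ≠ 2 * m → x ≠ predFun m (T (2 * m)) →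
      predFun m (T (predFun m (T x))) = x) :
    ∃ i < m - 1, ∀ x < 2 * m + 2, T x = matchingFun m (2 * (i + 1)) x := by
  have hne : ∀ x < 2 * m + 2, x ≠ 0 → x ≠ 2 * m + 1 → T x ≠ 0 ∧ T x ≠ 2 * m + 1 := by
    intro x hx hx0 hx1
    have := hTT x hx
    constructor <;> intro h <;> grind
  have hpred : ∀ x < 2 * m + 2, x ≠ 0 → x ≠ 2 * m + 1 → predFun m (T x) = T x - 1 := by
    intro x hx hx0 hx1
    have := hne x hx hx0 hx1
    simp [predFun, this]
  have hj0 := hne (2 * m) (by omega) (by omega) (by omega)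
  have hj1 := hlt (2 * m) (by omega)
  have hj2 := (hTT (2 * m) (by omega))
  rw [hpred (2 * m) (by omega) (by omega) (by omega)] at h4 hinv
  obtain ⟨j, hj⟩ : ∃ j, T (2 * m) = j + 1 := ⟨T (2 * m) - 1, by omega⟩
  simp only [hj, Nat.add_sub_cancel] at h4 hinv hj2 hj0 hj1
  have hjpos : j ≠ 0 := by
    rintro rfl
    rw [h0] at h4
    simp [predFun] at h4
  rw [hpred j (by omega) hjpos (by omega)] at h4
  have hj3 := hne j (by omega) hjpos (by omega)
  have hTj : T j = 1 := by omega
  have hT1 : T 1 = j := by rw [← hTj]; exact (hTT j (by omega)).1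
  have hstep : ∀ x, 0 < x → x < 2 * m → x ≠ j → T (x + 1) = T x - 1 := by
    intro x hx0 hxm hxj
    have h := hinv x (by omega) (by omega) (by omega) (by omega) hxj
    have hx := hne x (by omega) (by omega) (by omega)
    have hx' := hlt x (by omega)
    rw [hpred x (by omega) (by omega) (by omega)] at h
    have hTx : T x ≠ 1 := by
      intro h'
      have := (hTT x (by omega)).1
      rw [h'] at this
      omega
    rw [hpred _ (by omega) (by omega) (by omega)] at h
    rw [show x + 1 = T (T x - 1) by omega]
    exact (hTT _ (by omega)).1
  have hlow : ∀ x, 1 ≤ x → x ≤ j → T x = j + 1 - x := by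
    intro x hx
    induction x, hx using Nat.le_induction with
    | base => intro _; omega
    | succ x hx ih =>
      intro hxj
      rw [hstep x (by omega) (by omega) (by omega), ih (by omega)]
      omega
  have hhigh : ∀ x, j + 1 ≤ x → x ≤ 2 * m → T x = 2 * m + 1 + j - x := by
    intro x hx
    induction x, hx using Nat.le_induction with
    | base => intro _; omega
    | succ x hx ih =>
      intro hxj
      rw [hstep x (by omega) (by omega) (by omega), ih (by omega)]
      omega
  have hev : j % 2 = 0 := by
    by_contra hodd
    have h := hlow ((j + 1) / 2) (by omega) (by omega)
    have := (hTT ((j + 1) / 2) (by omega)).2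
    omega
  have hjm : j ≠ 2 * m := by
    rintro rfl
    omega
  refine ⟨j / 2 - 1, by omega, fun x hx => ?_⟩
  rw [show 2 * (j / 2 - 1 + 1) = j by omega]
  unfold matchingFun
  split_ifs with hx0 hx1 hxj
  · rw [hx0, h0]
  · rw [hx1, h1]
  · exact hlow x (by omega) hxj
  · exact hhigh x (by omega) (by omega)

theorem exists_eq_matching {m : ℕ} (hm : 0 < m) {t : Perm (Fin (2 * (m + 1)))}
    (ht : ∀ x, t (t x) = x ∧ t x ≠ x) (h0 : (t ⟨0, by omega⟩ : ℕ) = 2 * m + 1)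
    {a : ℕ} (hct : ((fixLastCycle m)⁻¹ * t).cycleType = 4 ::ₘ Multiset.replicate a 2) :
    ∃ i : Fin (m - 1), t = matching i := by
  obtain ⟨T, hT⟩ : ∃ T : ℕ → ℕ, ∀ x : Fin (2 * (m + 1)), (t x : ℕ) = T x :=
    ⟨fun n => if h : n < 2 * (m + 1) then t ⟨n, h⟩ else 0, fun x => by simp⟩
  have hlt : ∀ x < 2 * m + 2, T x < 2 * m + 2 := fun x hx => by
    have := (t ⟨x, hx⟩).2
    rwa [hT] at this
  have hTT : ∀ x < 2 * m + 2, T (T x) = x ∧ T x ≠ x := fun x hx => by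
    simpa [Fin.ext_iff, hT] using ht ⟨x, hx⟩
  rw [hT] at h0
  replace h0 : T 0 = 2 * m + 1 := h0
  have h1 : T (2 * m + 1) = 0 := by simpa [h0] using (hTT 0 (by omega)).1
  have hp0 : predFun m 0 = 2 * m := rfl
  have hp1 : predFun m (2 * m + 1) = 2 * m + 1 := by simp [predFun]
  obtain ⟨h4, hinv⟩ := of_cycleType_eq_four_cons hct (x := ⟨0, by omega⟩)
    (by simp only [mul_apply, ne_eq, Fin.ext_iff, fixLastCycle_inv_val, hT, h0, hp1]; omega)
    (by simp only [mul_apply, ne_eq, Fin.ext_iff, fixLastCycle_inv_val, hT, h0, hp1, h1, hp0]; omega)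
  simp only [pow_succ, pow_zero, one_mul, mul_apply, ne_eq, Fin.ext_iff, fixLastCycle_inv_val, hT,
    h0, hp1, h1, hp0] at h4 hinv
  obtain ⟨i, hi, h⟩ := exists_eq_matchingFun hlt hTT hm h0 h1 h4 fun x hx => hinv ⟨x, hx⟩
  refine ⟨⟨i, hi⟩, ?_⟩
  ext x
  rw [hT, matching_val, h x x.2]

theorem fixLastCycle_pow_zero {m n : ℕ} (hn : n ≤ 2 * m) :
    ((fixLastCycle m) ^ n) ⟨0, by omega⟩ = ⟨n, by omega⟩ := by
  induction n with
  | zero => rfl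
  | succ n ih =>
    rw [pow_succ', mul_apply, ih (by omega)]
    ext
    rw [fixLastCycle_val, if_neg (by simp; omega), if_neg (by simp; omega)]

theorem fixLastCycle_last {m : ℕ} :
    fixLastCycle m ⟨2 * m + 1, by omega⟩ = ⟨2 * m + 1, by omega⟩ := by
  ext
  rw [fixLastCycle_val]
  simp

theorem eq_last_of_fixLastCycle_apply_eq_self {m : ℕ} (hm : 0 < m) {x : Fin (2 * (m + 1))}
    (h : fixLastCycle m x = x) : x = ⟨2 * m + 1, by omega⟩ := by
  rw [Fin.ext_iff, fixLastCycle_val] at h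
  ext
  grind

theorem matching_zero {m : ℕ} (i : Fin (m - 1)) :
    matching i ⟨0, by omega⟩ = ⟨2 * m + 1, by omega⟩ := by
  ext
  simp [matching_val, matchingFun]

theorem matching_last {m : ℕ} (i : Fin (m - 1)) :
    matching i ⟨2 * m + 1, by omega⟩ = ⟨0, by omega⟩ := by
  ext
  simp [matching_val, matchingFun]

theorem matching_injective {m : ℕ} : Function.Injective (matching (m := m)) := by
  intro i j h
  have hi := i.2
  have h1 := congrArg Fin.val (DFunLike.congr_fun h ⟨1, by omega⟩)
  simp only [matching_val] at h1
  ext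
  grind [matchingFun]

theorem isTransitivePair_fixLastCycle {m : ℕ} (i : Fin (m - 1)) :
    IsTransitivePair (fixLastCycle m) ((fixLastCycle m)⁻¹ * matching i) := by
  set H := Subgroup.closure ({fixLastCycle m, (fixLastCycle m)⁻¹ * matching i} : Set (Perm _))
  have hc : fixLastCycle m ∈ H := Subgroup.subset_closure (by simp)
  have hs : (fixLastCycle m)⁻¹ * matching i ∈ H := Subgroup.subset_closure (by simp)
  have ht : matching i ∈ H := by simpa using H.mul_mem hc hs
  have key (x : Fin (2 * (m + 1))) : ∃ τ ∈ H, τ ⟨0, by omega⟩ = x := by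
    by_cases hx : (x : ℕ) ≤ 2 * m
    · exact ⟨_, H.pow_mem hc x, fixLastCycle_pow_zero hx⟩
    · refine ⟨_, ht, (matching_zero i).trans ?_⟩
      ext
      simp only
      omega
  intro x y
  obtain ⟨τ, hτ, rfl⟩ := key x
  obtain ⟨ρ, hρ, rfl⟩ := key y
  exact ⟨ρ * τ⁻¹, H.mul_mem hρ (H.inv_mem hτ), by simp⟩

theorem equivalence_simConj {d : ℕ}
    (S : Set (Perm (Fin d) × Perm (Fin d) × Perm (Fin d))) : Equivalence (SimConj S) where
  refl p := ⟨1, by simp⟩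
  symm := by
    rintro p q ⟨τ, h1, h2, h3⟩
    exact ⟨τ⁻¹, by rw [h1]; group, by rw [h2]; group, by rw [h3]; group⟩
  trans := by
    rintro p q r ⟨τ, h1, h2, h3⟩ ⟨ρ, h1', h2', h3'⟩
    exact ⟨ρ * τ, by rw [h1', h1]; group, by rw [h2', h2]; group, by rw [h3', h3]; group⟩

theorem mem_hurwitzTriples_iff {m : ℕ} (hm : 2 ≤ m)
    (p : Perm (Fin (2 * (m + 1))) × Perm (Fin (2 * (m + 1))) × Perm (Fin (2 * (m + 1)))) :
    p ∈ HurwitzTriples (2 * (m + 1)) {2 * (m + 1) - 1, 1}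
        (4 ::ₘ (Multiset.replicate (m + 1 - 3) 2 + Multiset.replicate 2 1))
        (Multiset.replicate (m + 1) 2) ↔
      p.1 * p.2.1 = p.2.2 ∧ p.1.cycleType = {2 * m + 1} ∧
        p.2.1.cycleType = 4 ::ₘ Multiset.replicate (m - 2) 2 ∧
        (∀ x, p.2.2 (p.2.2 x) = x ∧ p.2.2 x ≠ x) ∧ IsTransitivePair p.1 p.2.1 := by
  have e1 := fullCycleType_eq_iff (c := 1) p.1 (M := {2 * m + 1}) (by simp; omega) (by simp; omega)
  have e2 := fullCycleType_eq_iff (c := 2) p.2.1 (M := 4 ::ₘ Multiset.replicate (m - 2) 2)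
    (by
      intro x hx
      rcases Multiset.mem_cons.1 hx with rfl | hx
      · norm_num
      · rw [Multiset.eq_of_mem_replicate hx])
    (by simp; omega)
  have e3 := fullCycleType_eq_iff (c := 0) p.2.2 (M := Multiset.replicate (m + 1) 2)
    (fun x hx => by rw [Multiset.eq_of_mem_replicate hx]) (by simp; omega)
  rw [← cycleType_eq_replicate_two_iff, ← e1, ← e2, ← e3, HurwitzTriples, Set.mem_ofPred_eq,
    Multiset.cons_add, show m + 1 - 3 = m - 2 by omega,
    show 2 * (m + 1) - 1 = 2 * m + 1 by omega]
  simp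

theorem eq_of_conj_matching {m : ℕ} (hm : 0 < m) {i j : Fin (m - 1)}
    {τ : Perm (Fin (2 * (m + 1)))} (hc : fixLastCycle m = τ * fixLastCycle m * τ⁻¹)
    (ht : matching j = τ * matching i * τ⁻¹) : i = j := by
  rw [eq_mul_inv_iff_mul_eq] at hc ht
  have hlast : τ ⟨2 * m + 1, by omega⟩ = ⟨2 * m + 1, by omega⟩ := by
    apply eq_last_of_fixLastCycle_apply_eq_self hm
    rw [← mul_apply, hc, mul_apply, fixLastCycle_last]
  have hzero : τ ⟨0, by omega⟩ = ⟨0, by omega⟩ := by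
    rw [← matching_last i, ← mul_apply, ← ht, mul_apply, hlast, matching_last, matching_last]
  have hone : τ = 1 := by
    ext x
    by_cases hx : (x : ℕ) ≤ 2 * m
    · have hx' := fixLastCycle_pow_zero hx
      have hcomm : Commute ((fixLastCycle m) ^ (x : ℕ)) τ := Commute.pow_left hc _
      conv_lhs => rw [show x = ⟨x, x.2⟩ from rfl, ← hx', ← mul_apply, ← hcomm.eq, mul_apply,
        hzero, hx']
      rfl
    · rw [show x = ⟨2 * m + 1, by omega⟩ by ext; simp only; omega, hlast]
      rfl
  subst hone
  exact matching_injective (by simpa using ht.symm)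

theorem exists_conj_matching {m : ℕ} (hm : 0 < m) {σ s t : Perm (Fin (2 * (m + 1)))}
    (hmul : σ * s = t) (hσ : σ.cycleType = {2 * m + 1}) {a : ℕ}
    (hs : s.cycleType = 4 ::ₘ Multiset.replicate a 2) (ht : ∀ x, t (t x) = x ∧ t x ≠ x) :
    ∃ (i : Fin (m - 1)) (τ : Perm (Fin (2 * (m + 1)))),
      fixLastCycle m = τ * σ * τ⁻¹ ∧ matching i = τ * t * τ⁻¹ := by
  obtain ⟨ρ, hρ⟩ := isConj_iff.1 (isConj_iff_cycleType_eq.2 (hσ.trans (cycleType_fixLastCycle hm).symm))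
  have hconj (π : Perm (Fin (2 * (m + 1)))) (x) :
      (π * t * π⁻¹) ((π * t * π⁻¹) x) = x ∧ (π * t * π⁻¹) x ≠ x := by
    constructor
    · simp [(ht _).1]
    · intro h
      apply (ht (π⁻¹ x)).2
      apply π.injective
      simpa using h
  obtain ⟨n, hn, hn'⟩ : ∃ n, ∃ hn : n ≤ 2 * m,
      (ρ * t * ρ⁻¹) ⟨2 * m + 1, by omega⟩ = ⟨n, by omega⟩ := by
    refine ⟨(ρ * t * ρ⁻¹) ⟨2 * m + 1, by omega⟩, ?_, rfl⟩
    have := (hconj ρ ⟨2 * m + 1, by omega⟩).2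
    rw [ne_eq, Fin.ext_iff] at this
    have := ((ρ * t * ρ⁻¹) ⟨2 * m + 1, by omega⟩).2
    simp only at *
    omega
  set c := fixLastCycle m with hc
  set τ := (c ^ n)⁻¹ * ρ
  have hτσ : c = τ * σ * τ⁻¹ := by
    have : τ * σ * τ⁻¹ = (c ^ n)⁻¹ * (ρ * σ * ρ⁻¹) * c ^ n := by
      simp only [τ]; group
    rw [this, hρ]
    group
  have hlast : (τ * t * τ⁻¹) ⟨2 * m + 1, by omega⟩ = ⟨0, by omega⟩ := by
    have h : τ * t * τ⁻¹ = (c ^ n)⁻¹ * (ρ * t * ρ⁻¹) * c ^ n := by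
      simp only [τ]; group
    rw [h, mul_apply, pow_apply_eq_self_of_apply_eq_self fixLastCycle_last, mul_apply, hn',
      ← fixLastCycle_pow_zero hn]
    simp [hc]
  have hzero : (τ * t * τ⁻¹) ⟨0, by omega⟩ = ⟨2 * m + 1, by omega⟩ := by
    rw [← hlast]
    exact (hconj τ _).1
  have hct : (c⁻¹ * (τ * t * τ⁻¹)).cycleType = 4 ::ₘ Multiset.replicate a 2 := by
    rw [← hs, ← cycleType_conj (σ := s) (τ := τ)]
    congr 1
    conv_lhs => rw [hτσ, ← hmul]
    group
  obtain ⟨i, hi⟩ := exists_eq_matching hm (hconj τ) (by rw [hzero]) hct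
  exact ⟨i, τ, hτσ, hi.symm⟩

/-- Proposition 2.3, row 7: for `k ≥ 3`, the number of simultaneous-conjugacy classes
of transitive triples `(σ₁, σ₂, σ₃)` in `S_{2k}` with `σ₁σ₂ = σ₃`, `σ₁` of cycle type
`(2k-1, 1)`, `σ₂` of cycle type `(4, 2, …, 2, 1, 1)` and `σ₃` a fixed-point-free
involution equals `k - 2`. -/
theorem hurwitz_count_row7 (k : ℕ) (hk : 3 ≤ k) :
    Nat.card (Quot (SimConj
      (HurwitzTriples (2 * k) {2 * k - 1, 1}
        (4 ::ₘ (Multiset.replicate (k - 3) 2 + Multiset.replicate 2 1))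
        (Multiset.replicate k 2)))) = k - 2 := by
  obtain ⟨m, rfl⟩ : ∃ m, k = m + 1 := ⟨k - 1, by omega⟩
  have hm : 2 ≤ m := by omega
  have hmem (i : Fin (m - 1)) := (mem_hurwitzTriples_iff hm
    (fixLastCycle m, (fixLastCycle m)⁻¹ * matching i, matching i)).2
    ⟨by simp, cycleType_fixLastCycle (by omega), cycleType_fixLastCycle_inv_mul_matching i,
      matching_involutive_fixedPointFree i, isTransitivePair_fixLastCycle i⟩
  rw [show m + 1 - 2 = m - 1 by omega, ← Nat.card_fin (m - 1)]
  symm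
  refine Nat.card_eq_of_bijective (fun i => Quot.mk _ ⟨_, hmem i⟩) ⟨fun i j hij => ?_, ?_⟩
  · obtain ⟨τ, h1, -, h3⟩ := (equivalence_simConj _).eqvGen_iff.1 (Quot.eqvGen_exact hij)
    exact eq_of_conj_matching (by omega) h1 h3
  · rintro ⟨⟨⟨σ, s, t⟩, hp⟩⟩
    obtain ⟨hmul, hσ, hs, ht, -⟩ := (mem_hurwitzTriples_iff hm _).1 hp
    obtain ⟨i, τ, h1, h2⟩ := exists_conj_matching (by omega) hmul hσ hs ht
    refine ⟨i, (Quot.sound ⟨τ, h1, ?_, h2⟩).symm⟩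
    change (fixLastCycle m)⁻¹ * matching i = τ * s * τ⁻¹
    rw [h1, h2, ← show σ * s = t from hmul]
    group
end
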